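/- There exist positive real constants c₁ and c₂ and a threshold N such that for every finite set A ⊆ ℝ with |A| ≥ N and |A+A| ≤ |A|^(1+c₁), the fourfold product set satisfies |AAAA| ≥ |A|^(2+c₂). -/

import Mathlib

open Finset Pointwise

/-- A finite set of reals has a successor function, defined off its maximum. -/
lemma exists_succ_function (Q : Finset ℝ) :
    ∃ I ⊆ Q, ∃ s : ℝ → ℝ, #Q ≤ #I + 1 ∧
      ∀ q ∈ I, s q ∈ Q ∧ q < s q ∧ ∀ x ∈ Q, q < x → s q ≤ x := by
  classical
  have key : ∀ q : ℝ, ∃ y : ℝ, (∃ x ∈ Q, q < x) → y ∈ Q ∧ q < y ∧ ∀ x ∈ Q, q < x → y ≤ x := by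
    intro q
    by_cases h : ∃ x ∈ Q, q < x
    · obtain ⟨x, hx, hqx⟩ := h
      obtain ⟨y, hy, hmin⟩ := exists_min_image (Q.filter (q < ·)) id ⟨x, by simp [hx, hqx]⟩
      rw [mem_filter] at hy
      exact ⟨y, fun _ => ⟨hy.1, hy.2, fun z hz hqz => hmin z (by simp [hz, hqz])⟩⟩
    · exact ⟨0, fun h' => absurd h' h⟩
  choose s hs using key
  refine ⟨Q.filter (fun q => ∃ x ∈ Q, q < x), filter_subset _ _, s, ?_, fun q hq =>
    hs q (mem_filter.1 hq).2⟩
  rcases Q.eq_empty_or_nonempty with rfl | hQ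
  · simp
  · refine (Finset.card_le_card (t := insert (Q.max' hQ) (Q.filter fun q => ∃ x ∈ Q, q < x))
      fun q hq => ?_).trans (card_insert_le _ _)
    rcases (Q.le_max' q hq).eq_or_lt with h | h
    · simp [← h]
    · exact mem_insert_of_mem (mem_filter.2 ⟨hq, _, Q.max'_mem hQ, h⟩)

/-- If `A` has few elements in `A + A - A`, then some gap `d` between consecutive elements of `A`
occurs for a large proportion of `A`. -/
lemma exists_popular_gap (A : Finset ℝ) (hA : 2 ≤ #A) :
    ∃ d > 0, ∃ B ⊆ A, (∀ a ∈ B, a + d ∈ A ∧ ∀ x ∈ A, a < x → a + d ≤ x) ∧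
      #A ^ 2 ≤ 16 * #(A + A - A) * #B := by
  classical
  obtain ⟨I, hI, s, hcard, hs⟩ := exists_succ_function A
  set S := A + A - A with hS
  have hSpos : 0 < #S := by
    have : A.Nonempty := card_pos.1 (by omega)
    exact card_pos.2 ((this.add this).sub this)
  set c : ℝ → ℕ := fun a => #(S.filter fun x => a < x ∧ x ≤ s a) with hc
  have hsum : ∑ a ∈ I, c a ≤ #S := by
    rw [hc, ← card_biUnion]
    · exact card_le_card (biUnion_subset.2 fun a _ => filter_subset _ _)
    · intro a ha b hb hab
      refine disjoint_filter.2 fun x _ hax hbx => ?_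
      rcases lt_or_gt_of_ne hab with h | h
      · linarith [(hs a ha).2.2 b (hI hb) h]
      · linarith [(hs b hb).2.2 a (hI ha) h]
  set G := I.filter fun a => c a * #A ≤ 4 * #S with hG
  have hbad : 4 * #(I.filter fun a => ¬ c a * #A ≤ 4 * #S) ≤ #A := by
    have h1 : #(I.filter fun a => ¬ c a * #A ≤ 4 * #S) * (4 * #S) ≤ #S * #A := by
      calc _ = ∑ a ∈ I.filter fun a => ¬ c a * #A ≤ 4 * #S, (4 * #S) := by simp
        _ ≤ ∑ a ∈ I.filter fun a => ¬ c a * #A ≤ 4 * #S, c a * #A :=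
          sum_le_sum fun a ha => (not_le.1 (mem_filter.1 ha).2).le
        _ ≤ ∑ a ∈ I, c a * #A := sum_le_sum_of_subset (filter_subset _ _)
        _ = (∑ a ∈ I, c a) * #A := (sum_mul _ _ _).symm
        _ ≤ _ := by gcongr
    nlinarith
  have hGcard : #A ≤ 4 * #G := by
    have := card_filter_add_card_filter_not (s := I) (fun a => c a * #A ≤ 4 * #S)
    rw [← hG] at this
    omega
  have hGne : G.Nonempty := card_pos.1 (by omega)
  set D := G.image fun a => s a - a with hD
  have hDne : D.Nonempty := hGne.image _
  have hDcard : #D * #A ≤ 4 * #S := by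
    obtain ⟨a, ha, hmax⟩ := exists_max_image G (fun a => s a - a) hGne
    have haI := (mem_filter.1 ha).1
    refine le_trans (Nat.mul_le_mul_right _ ?_) (mem_filter.1 ha).2
    refine card_le_card_of_injOn (fun x => a + x) ?_ (add_right_injective a).injOn
    intro x hx
    obtain ⟨b, hb, rfl⟩ := mem_image.1 (mem_coe.1 hx)
    have hbI := (mem_filter.1 hb).1
    have h1 := hmax b hb
    have h2 := (hs b hbI).2.1
    refine mem_coe.2 (mem_filter.2 ⟨?_, ?_, ?_⟩)
    · change a + (s b - b) ∈ S
      rw [← add_sub_assoc]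
      exact sub_mem_sub (add_mem_add (hI haI) (hs b hbI).1) (hI hbI)
    · linarith
    · linarith
  obtain ⟨d, hd, hmax⟩ := exists_max_image D (fun d => #(G.filter fun a => s a - a = d)) hDne
  have hGD := card_le_mul_card_image (s := G) (f := fun a => s a - a) _ hmax
  refine ⟨d, ?_, G.filter fun a => s a - a = d, ?_, ?_, ?_⟩
  · obtain ⟨b, hb, rfl⟩ := mem_image.1 hd
    have := (hs b (mem_filter.1 hb).1).2.1
    linarith
  · exact (filter_subset _ _).trans ((filter_subset _ _).trans hI)
  · intro a ha
    obtain ⟨haG, rfl⟩ := mem_filter.1 ha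
    have := hs a (mem_filter.1 haG).1
    simpa using ⟨this.1, this.2.2⟩
  · calc #A ^ 2 ≤ 4 * #G * #A := by nlinarith
      _ ≤ 4 * (#(G.filter fun a => s a - a = d) * #D) * #A := by gcongr
      _ = 4 * #(G.filter fun a => s a - a = d) * (#D * #A) := by ring
      _ ≤ 4 * #(G.filter fun a => s a - a = d) * (4 * #S) := by gcongr
      _ = _ := by ring

/-- The points of `A × A` on the line of slope `q` through the origin. -/
noncomputable def slopeFiber (A : Finset ℝ) (q : ℝ) : Finset (ℝ × ℝ) :=
  (A ×ˢ A).filter fun p => p.2 = q * p.1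

lemma card_mul_sq_le_of_le_card_slopeFiber {A : Finset ℝ} (hA : ∀ a ∈ A, 0 < a) (t : ℕ)
    (Q : Finset ℝ) (hQ : ∀ q ∈ Q, t ≤ #(slopeFiber A q)) :
    #Q * t ^ 2 ≤ #(A + A) ^ 2 + t ^ 2 := by
  obtain ⟨I, hI, s, hcard, hs⟩ := exists_succ_function Q
  have hmain : #(I.sigma fun q => slopeFiber A q ×ˢ slopeFiber A (s q)) ≤
      #((A + A) ×ˢ (A + A)) := by
    refine card_le_card_of_injOn (fun x => x.2.1 + x.2.2) ?_ ?_
    · rintro ⟨q, p, p'⟩ hx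
      simp only [slopeFiber, coe_sigma, Set.mem_sigma_iff, mem_coe, mem_product, mem_filter] at hx
      exact mem_coe.2 (mem_product.2
        ⟨add_mem_add hx.2.1.1.1 hx.2.2.1.1, add_mem_add hx.2.1.1.2 hx.2.2.1.2⟩)
    · rintro ⟨q, ⟨a, b⟩, ⟨a', b'⟩⟩ hx ⟨r, ⟨c, e⟩, ⟨c', e'⟩⟩ hy hxy
      simp only [slopeFiber, coe_sigma, Set.mem_sigma_iff, mem_coe, mem_product, mem_filter]
        at hx hy
      obtain ⟨hq, ⟨⟨ha, -⟩, rfl⟩, ⟨ha', -⟩, rfl⟩ := hx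
      obtain ⟨hr, ⟨⟨hc, -⟩, rfl⟩, ⟨hc', -⟩, rfl⟩ := hy
      simp only [Prod.mk_add_mk, Prod.mk.injEq] at hxy
      obtain ⟨h1, h2⟩ := hxy
      have ha0 := hA _ ha
      have ha0' := hA _ ha'
      have hc0 := hA _ hc
      have hc0' := hA _ hc'
      have hq' := hs q hq
      have hr' := hs r hr
      have hqr : q = r := by
        rcases lt_trichotomy q r with h | h | h
        · have h3 := hq'.2.2 r (hI hr) h
          have e1 : q * a + s q * a' < s q * (a + a') := by nlinarith
          have e2 : r * (c + c') < r * c + s r * c' := by nlinarith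
          have e3 : s q * (a + a') ≤ r * (a + a') := by gcongr
          rw [h1] at e3 e1
          linarith
        · exact h
        · have h3 := hr'.2.2 q (hI hq) h
          have e1 : r * c + s r * c' < s r * (c + c') := by nlinarith
          have e2 : q * (a + a') < q * a + s q * a' := by nlinarith
          have e3 : s r * (c + c') ≤ q * (c + c') := by gcongr
          rw [h1] at e2
          linarith
      subst hqr
      have h4 : (s q - q) * (a' - c') = 0 := by linear_combination h2 - q * h1
      have h5 : a' = c' := by
        rcases mul_eq_zero.1 h4 with h | h
        · linarith [hq'.2.1]
        · linarith
      subst h5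
      have h6 : a = c := by linarith
      subst h6
      rfl
  rw [card_sigma, card_product] at hmain
  have h2 : #I * t ^ 2 ≤ #(A + A) * #(A + A) := by
    refine le_trans ?_ hmain
    calc #I * t ^ 2 = ∑ q ∈ I, t * t := by simp [sq]
      _ ≤ _ := sum_le_sum fun q hq => by
        rw [card_product]
        exact Nat.mul_le_mul (hQ q (hI hq)) (hQ _ (hs q hq).1)
  nlinarith [Nat.mul_le_mul_right (t ^ 2) hcard]

lemma mulEnergy_le_sum_card_slopeFiber {A : Finset ℝ} (hA : ∀ a ∈ A, 0 < a) :
    mulEnergy A A ≤ ∑ q ∈ A / A, #(slopeFiber A q) ^ 2 := by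
  have h : mulEnergy A A ≤ #((A / A).sigma fun q => slopeFiber A q ×ˢ slopeFiber A q) := by
    refine card_le_card_of_injOn
      (fun x => ⟨x.1.1 / x.1.2, ((x.1.2, x.1.1), (x.2.1, x.2.2))⟩) ?_ ?_
    · rintro ⟨⟨a, b⟩, c, e⟩ hx
      simp only [mem_coe, mem_filter, mem_product] at hx
      obtain ⟨⟨⟨ha, hb⟩, hc, he⟩, h⟩ := hx
      have hb0 := (hA b hb).ne'
      simp only [slopeFiber, mem_coe, mem_sigma, mem_product, mem_filter, ha, hb, hc, he,
        div_mem_div ha hb, true_and]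
      constructor
      · field_simp
      · field_simp; linarith
    · rintro ⟨⟨a, b⟩, c, e⟩ - ⟨⟨a', b'⟩, c', e'⟩ - h
      simp only [Sigma.mk.injEq, heq_eq_eq, Prod.mk.injEq] at h
      simp [h.2.1.1, h.2.1.2, h.2.2.1, h.2.2.2]
  simpa only [card_sigma, card_product, ← sq] using h

/-- Solymosi's bound for the multiplicative energy. -/
lemma mulEnergy_le_card_add_sq_mul_harmonic {A : Finset ℝ} (hA : ∀ a ∈ A, 0 < a) :
    (mulEnergy A A : ℝ) ≤ 4 * (#(A + A) : ℝ) ^ 2 * (harmonic #A : ℝ) := by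
  have hr : ∀ q, #(slopeFiber A q) ≤ #A := by
    intro q
    refine card_le_card_of_injOn Prod.fst ?_ ?_
    · intro p hp
      exact (mem_product.1 (mem_filter.1 (mem_coe.1 hp)).1).1
    · intro p hp p' hp' h
      refine Prod.ext h ?_
      rw [(mem_filter.1 (mem_coe.1 hp)).2, (mem_filter.1 (mem_coe.1 hp')).2, h]
  have hn : #A ≤ #(A + A) := by
    rcases A.eq_empty_or_nonempty with rfl | h
    · simp
    · exact card_le_card_add_right h
  have hsq : ∀ q, #(slopeFiber A q) ^ 2 ≤
      ∑ t ∈ Icc 1 #A, if t ≤ #(slopeFiber A q) then 2 * t else 0 := by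
    intro q
    rw [← sum_filter]
    have : (Icc 1 #A).filter (· ≤ #(slopeFiber A q)) = Icc 1 #(slopeFiber A q) := by
      ext t
      have := hr q
      simp only [mem_filter, mem_Icc]
      omega
    rw [this]
    generalize #(slopeFiber A q) = k
    induction k with
    | zero => simp
    | succ k ih => rw [sum_Icc_succ_top (by omega)]; nlinarith
  have hE : mulEnergy A A ≤
      ∑ t ∈ Icc 1 #A, 2 * t * #((A / A).filter fun q => t ≤ #(slopeFiber A q)) := by
    calc mulEnergy A A ≤ ∑ q ∈ A / A, #(slopeFiber A q) ^ 2 := mulEnergy_le_sum_card_slopeFiber hA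
      _ ≤ ∑ q ∈ A / A, ∑ t ∈ Icc 1 #A, if t ≤ #(slopeFiber A q) then 2 * t else 0 :=
        sum_le_sum fun q _ => hsq q
      _ = _ := by
        rw [sum_comm]
        refine sum_congr rfl fun t _ => ?_
        rw [← sum_filter, sum_const, smul_eq_mul, mul_comm]
  have hE' : (mulEnergy A A : ℝ) ≤
      ∑ t ∈ Icc 1 #A, 2 * t * (#((A / A).filter fun q => t ≤ #(slopeFiber A q)) : ℝ) := by
    exact_mod_cast hE
  refine hE'.trans ?_
  rw [harmonic_eq_sum_Icc]
  push_cast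
  rw [mul_sum]
  refine sum_le_sum fun t ht => ?_
  rw [mem_Icc] at ht
  have ht0 : (0 : ℝ) < t := by exact_mod_cast ht.1
  have h1 := card_mul_sq_le_of_le_card_slopeFiber hA t
    ((A / A).filter fun q => t ≤ #(slopeFiber A q)) fun q hq => (mem_filter.1 hq).2
  have h2 : #((A / A).filter fun q => t ≤ #(slopeFiber A q)) * t ^ 2 ≤ 2 * #(A + A) ^ 2 := by
    have : t ^ 2 ≤ #(A + A) ^ 2 := Nat.pow_le_pow_left (ht.2.trans hn) 2
    omega
  have h3 : (#((A / A).filter fun q => t ≤ #(slopeFiber A q)) : ℝ) * t ^ 2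
      ≤ 2 * (#(A + A) : ℝ) ^ 2 := by exact_mod_cast h2
  rw [← div_eq_mul_inv, le_div_iff₀ ht0]
  linarith

/-- Iterated squeezing: sums of increments of `log` over two nested families of gaps are separated,
giving a cubic number of elements in an iterated sum and difference set of `log A`. -/
lemma cube_le_card_nsmul_sub_nsmul_image_log {A A₁ A₂ : Finset ℝ} (hA : ∀ a ∈ A, 0 < a)
    {d d' : ℝ} (hd : 0 < d) (hd' : 0 < d') (hA₁ : A₁ ⊆ A) (hA₂ : A₂ ⊆ A₁)
    (h₁ : ∀ a ∈ A₁, a + d ∈ A ∧ ∀ x ∈ A, a < x → a + d ≤ x)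
    (h₂ : ∀ a ∈ A₂, a + d' ∈ A₁ ∧ ∀ x ∈ A₁, a < x → a + d' ≤ x) :
    (#A₂ / 3) ^ 3 ≤ #(2 • (A.image Real.log + A.image Real.log) -
      2 • (A.image Real.log + A.image Real.log)) := by
  classical
  set t := #A₂ / 3 with ht
  rcases t.eq_zero_or_pos with ht0 | ht0
  · simp [ht0]
  have ht3 : 3 * t ≤ #A₂ := by omega
  obtain ⟨x₀, hx₀⟩ : A.Nonempty :=
    (card_pos.1 (by omega : 0 < #A₂)).mono (hA₂.trans hA₁)
  set g : ℝ → ℝ := fun x => Real.log (x + d) - Real.log x with hg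
  set h : ℝ → ℝ := fun x => g x - g (x + d') with hh
  have hganti : ∀ x y, 0 < x → x ≤ y → g y ≤ g x := by
    intro x y hx hxy
    have hy : 0 < y := hx.trans_le hxy
    simp only [hg]
    rw [← Real.log_div (by positivity) (by positivity),
      ← Real.log_div (by positivity) (by positivity)]
    apply Real.log_le_log (by positivity)
    rw [div_le_div_iff₀ hy hx]
    nlinarith
  have hgpos : ∀ x, 0 < x → 0 < g x := fun x hx =>
    sub_pos.2 (Real.log_lt_log hx (by linarith))
  have hform : ∀ x, 0 < x →
      h x = Real.log (1 + d * d' / (x * (x + d + d'))) := by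
    intro x hx
    have : 1 + d * d' / (x * (x + d + d')) = (x + d) / x / ((x + d' + d) / (x + d')) := by
      field_simp
      ring
    rw [this, Real.log_div (by positivity) (by positivity),
      Real.log_div (by positivity) (by positivity), Real.log_div (by positivity) (by positivity)]
  have hhanti : ∀ x y, 0 < x → x < y → h y < h x := by
    intro x y hx hxy
    have hy : 0 < y := hx.trans hxy
    rw [hform x hx, hform y hy]
    apply Real.log_lt_log (by positivity)
    gcongr
  have hhpos : ∀ x, 0 < x → 0 < h x := by
    intro x hx
    rw [hform x hx]
    apply Real.log_pos
    have : 0 < d * d' / (x * (x + d + d')) := by positivity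
    linarith
  let e := A₂.orderEmbOfFin rfl
  have he : ∀ i, e i ∈ A₂ := fun i => A₂.orderEmbOfFin_mem rfl i
  let u : Fin t → ℝ := fun i => e ⟨i, by omega⟩
  let v : Fin t → ℝ := fun i => e ⟨t + i, by omega⟩
  let w : Fin t → ℝ := fun i => e ⟨2 * t + i, by omega⟩
  have hu : ∀ i, u i ∈ A₂ := fun i => he _
  have hv : ∀ i, v i ∈ A₂ := fun i => he _
  have hw : ∀ i, w i ∈ A₂ := fun i => he _
  have huv : ∀ i j, u i < v j := fun i j =>
    e.strictMono (by simp only [Fin.mk_lt_mk]; omega)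
  have hvw : ∀ i j, v i < w j := fun i j =>
    e.strictMono (by simp only [Fin.mk_lt_mk]; omega)
  have hui : u.Injective := fun i j hij => by
    have := e.injective hij
    simp only [Fin.mk.injEq] at this
    exact Fin.ext this
  have hvi : v.Injective := fun i j hij => by
    have := e.injective hij
    simp only [Fin.mk.injEq] at this
    exact Fin.ext (by omega)
  have hwi : w.Injective := fun i j hij => by
    have := e.injective hij
    simp only [Fin.mk.injEq] at this
    exact Fin.ext (by omega)
  have hpos : ∀ a ∈ A₂, 0 < a := fun a ha => hA a (hA₁ (hA₂ ha))
  let val : Fin t × Fin t × Fin t → ℝ := fun p =>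
    Real.log (u p.1) + (g (v p.2.1 + d') + h (w p.2.2)) - Real.log x₀
  have hsq : ∀ j k, g (v j + d') < g (v j + d') + h (w k) ∧
      g (v j + d') + h (w k) < g (v j) := by
    intro j k
    refine ⟨by linarith [hhpos _ (hpos _ (hw k))], ?_⟩
    have := hhanti _ _ (hpos _ (hv j)) (hvw j k)
    have h3 : h (v j) = g (v j) - g (v j + d') := rfl
    linarith
  have hstep₁ : ∀ i i' j j' k k', u i < u i' → val (i, j, k) < val (i', j', k') := by
    intro i i' j j' k k' hlt
    have e1 := (h₁ _ (hA₂ (hu i))).2 _ (hA₁ (hA₂ (hu i'))) hlt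
    have e2 : Real.log (u i + d) ≤ Real.log (u i') :=
      Real.log_le_log (by linarith [hpos _ (hu i)]) e1
    have e3 := hganti _ _ (hpos _ (hu i)) (huv i j).le
    have e4 := (hsq j k).2
    have e5 := (hsq j' k').1
    have e6 := hgpos (v j' + d') (by linarith [hpos _ (hv j')])
    have e7 : g (u i) = Real.log (u i + d) - Real.log (u i) := rfl
    simp only [val]
    linarith
  have hstep₂ : ∀ j j' k k', v j < v j' → g (v j' + d') + h (w k') < g (v j + d') + h (w k) := by
    intro j j' k k' hlt
    have e1 := (h₂ _ (hv j)).2 _ (hA₂ (hv j')) hlt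
    have e2 := hganti _ _ (by linarith [hpos _ (hv j)]) e1
    linarith [(hsq j' k').2, (hsq j k).1]
  have hinj : val.Injective := by
    rintro ⟨i, j, k⟩ ⟨i', j', k'⟩ heq
    have hi : i = i' := by
      by_contra hne
      rcases lt_or_gt_of_ne (hui.ne hne) with hlt | hlt
      · exact (hstep₁ i i' j j' k k' hlt).ne heq
      · exact (hstep₁ i' i j' j k' k hlt).ne' heq
    subst hi
    have heq' : g (v j + d') + h (w k) = g (v j' + d') + h (w k') := by
      simp only [val] at heq
      linarith
    have hj : j = j' := by
      by_contra hne
      rcases lt_or_gt_of_ne (hvi.ne hne) with hlt | hlt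
      · exact (hstep₂ j j' k k' hlt).ne' heq'
      · exact (hstep₂ j' j k' k hlt).ne heq'
    subst hj
    have hk : k = k' := by
      by_contra hne
      rcases lt_or_gt_of_ne (hwi.ne hne) with hlt | hlt
      · linarith [hhanti _ _ (hpos _ (hw k)) hlt]
      · linarith [hhanti _ _ (hpos _ (hw k')) hlt]
    rw [hk]
  have hmem : ∀ p, val p ∈ 2 • (A.image Real.log + A.image Real.log) -
      2 • (A.image Real.log + A.image Real.log) := by
    rintro ⟨i, j, k⟩
    have hL : ∀ a ∈ A, Real.log a ∈ A.image Real.log := fun a ha => mem_image_of_mem _ ha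
    have m1 := hL _ (hA₁ (hA₂ (hu i)))
    have m2 := hL _ (h₁ _ (h₂ _ (hv j)).1).1
    have m3 := hL _ (hA₁ (h₂ _ (hv j)).1)
    have m4 := hL _ (h₁ _ (hA₂ (hw k))).1
    have m5 := hL _ (hA₁ (hA₂ (hw k)))
    have m6 := hL _ (h₁ _ (h₂ _ (hw k)).1).1
    have m7 := hL _ (hA₁ (h₂ _ (hw k)).1)
    have : val (i, j, k) =
        ((Real.log (u i) + Real.log (v j + d' + d)) + (Real.log (w k + d) + Real.log (w k + d'))) -
        ((Real.log (v j + d') + Real.log (w k)) + (Real.log (w k + d' + d) + Real.log x₀)) := by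
      simp only [val, hh, hg]
      ring
    rw [this, two_nsmul]
    exact sub_mem_sub (add_mem_add (add_mem_add m1 m2) (add_mem_add m4 m7))
      (add_mem_add (add_mem_add m3 m5) (add_mem_add m6 (hL _ hx₀)))
  calc t ^ 3 = #(univ.image val) := by
        rw [card_image_of_injective _ hinj]
        simp
        ring
    _ ≤ _ := card_le_card (image_subset_iff.2 fun p _ => hmem p)

lemma card_add_sub_mul_sq_le {A : Finset ℝ} (hA : A.Nonempty) :
    #(A + A - A) * #A ^ 2 ≤ #(A + A) ^ 3 := by
  have h := pluennecke_ruzsa_inequality_nsmul_sub_nsmul_add hA A 2 1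
  have hn : (0 : ℚ≥0) < #A := by exact_mod_cast hA.card_pos
  rw [two_nsmul, one_nsmul, div_pow, div_mul_eq_mul_div, le_div_iff₀ (by positivity)] at h
  norm_cast at h
  refine Nat.le_of_mul_le_mul_right (le_of_eq_of_le ?_ h) hA.card_pos
  ring

lemma card_nsmul_sub_nsmul_mul_cube_le {X : Finset ℝ} (hX : X.Nonempty) :
    #(2 • X - 2 • X) * #X ^ 3 ≤ #(X + X) ^ 4 := by
  have h := pluennecke_ruzsa_inequality_nsmul_sub_nsmul_add hX X 2 2
  have hn : (0 : ℚ≥0) < #X := by exact_mod_cast hX.card_pos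
  rw [div_pow, div_mul_eq_mul_div, le_div_iff₀ (by positivity)] at h
  norm_cast at h
  refine Nat.le_of_mul_le_mul_right (le_of_eq_of_le ?_ h) hX.card_pos
  ring

lemma image_log_add_image_log {A B : Finset ℝ} (hA : ∀ a ∈ A, 0 < a) (hB : ∀ b ∈ B, 0 < b) :
    A.image Real.log + B.image Real.log = (A * B).image Real.log := by
  ext x
  simp only [mem_add, mem_image, mem_mul]
  constructor
  · rintro ⟨_, ⟨a, ha, rfl⟩, _, ⟨b, hb, rfl⟩, rfl⟩
    exact ⟨_, ⟨a, ha, b, hb, rfl⟩, Real.log_mul (hA a ha).ne' (hB b hb).ne'⟩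
  · rintro ⟨_, ⟨a, ha, b, hb, rfl⟩, rfl⟩
    exact ⟨_, ⟨a, ha, rfl⟩, _, ⟨b, hb, rfl⟩, (Real.log_mul (hA a ha).ne' (hB b hb).ne').symm⟩

lemma card_image_log {A : Finset ℝ} (hA : ∀ a ∈ A, 0 < a) : #(A.image Real.log) = #A :=
  card_image_of_injOn fun _ ha _ hb h => Real.log_injOn_pos (hA _ ha) (hA _ hb) h

/-- A quantitative form of few sums, many products for positive reals: `K` bounds the additive
doubling, the growth of the fourfold product set and a logarithmic factor. -/
lemma card_le_of_card_add_le_of_card_mul_le {A : Finset ℝ} (hA : ∀ a ∈ A, 0 < a) (hn : 2 ≤ #A)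
    {K : ℝ} (hK : 1 ≤ K) (hs : (#(A + A) : ℝ) ≤ K * #A)
    (hQ : (#(A * A * A * A) : ℝ) ≤ K * (#A : ℝ) ^ 2) (hH : (harmonic #A : ℝ) ≤ K) :
    (#A : ℝ) ≤ 10 ^ 15 * K ^ 40 := by
  have hne : A.Nonempty := card_pos.1 (by omega)
  have hK0 : 0 < K := by linarith
  have hn0 : (0 : ℝ) < #A := by exact_mod_cast hne.card_pos
  obtain ⟨d, hd, A₁, hA₁, h₁, hc₁⟩ := exists_popular_gap A hn
  set F := A.image Real.log with hF
  have hAA : ∀ a ∈ A * A, 0 < a := by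
    intro a ha
    obtain ⟨x, hx, y, hy, rfl⟩ := mem_mul.1 ha
    exact mul_pos (hA x hx) (hA y hy)
  have hFF : F + F = (A * A).image Real.log := image_log_add_image_log hA hA
  have hX : #(F + F) = #(A * A) := by rw [hFF, card_image_log hAA]
  have hXX : #(F + F + (F + F)) ≤ #(A * A * A * A) := by
    rw [hFF, image_log_add_image_log hAA hAA, ← mul_assoc]
    exact card_image_le
  have hS : (#(A + A - A) : ℝ) ≤ K ^ 3 * #A := by
    have h : (#(A + A - A) : ℝ) * (#A : ℝ) ^ 2 ≤ (#(A + A) : ℝ) ^ 3 := by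
      exact_mod_cast card_add_sub_mul_sq_le hne
    have h' : (#(A + A) : ℝ) ^ 3 ≤ (K * #A) ^ 3 := by gcongr
    refine le_of_mul_le_mul_right (h.trans (h'.trans_eq ?_)) (pow_pos hn0 2)
    ring
  have hn₁ : (#A : ℝ) ≤ 16 * K ^ 3 * #A₁ := by
    have h : (#A : ℝ) ^ 2 ≤ 16 * #(A + A - A) * #A₁ := by exact_mod_cast hc₁
    have h' : 16 * (#(A + A - A) : ℝ) * #A₁ ≤ 16 * (K ^ 3 * #A) * #A₁ := by gcongr
    refine le_of_mul_le_mul_right (le_of_eq_of_le ?_ (h.trans (h'.trans_eq ?_))) hn0 <;> ring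
  have hK40 : 0 < K ^ 40 := by positivity
  rcases lt_or_ge #A₁ 2 with hm₁ | hm₁
  · have h : (#A₁ : ℝ) ≤ 2 := by exact_mod_cast hm₁.le
    have : 16 * K ^ 3 * #A₁ ≤ 16 * K ^ 40 * 2 := by
      gcongr
      norm_num
    linarith
  obtain ⟨d', hd', A₂, hA₂, h₂, hc₂⟩ := exists_popular_gap A₁ hm₁
  have hn₂ : (#A : ℝ) ≤ 4096 * K ^ 9 * #A₂ := by
    have h : (#A₁ : ℝ) ^ 2 ≤ 16 * #(A₁ + A₁ - A₁) * #A₂ := by exact_mod_cast hc₂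
    have hsub : (#(A₁ + A₁ - A₁) : ℝ) ≤ #(A + A - A) := by
      exact_mod_cast card_le_card (sub_subset_sub (add_subset_add hA₁ hA₁) hA₁)
    have h' : (#A : ℝ) ^ 2 ≤ (16 * K ^ 3) ^ 2 * (16 * (K ^ 3 * #A) * #A₂) := by
      calc (#A : ℝ) ^ 2 ≤ (16 * K ^ 3 * #A₁) ^ 2 := by gcongr
        _ = (16 * K ^ 3) ^ 2 * (#A₁ : ℝ) ^ 2 := by ring
        _ ≤ (16 * K ^ 3) ^ 2 * (16 * #(A₁ + A₁ - A₁) * #A₂) := by gcongr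
        _ ≤ _ := by gcongr; exact hsub.trans hS
    refine le_of_mul_le_mul_right (le_of_eq_of_le ?_ (h'.trans_eq ?_)) hn0 <;> ring
  rcases lt_or_ge #A₂ 6 with hm₂ | hm₂
  · have h : (#A₂ : ℝ) ≤ 6 := by exact_mod_cast hm₂.le
    have : 4096 * K ^ 9 * #A₂ ≤ 4096 * K ^ 40 * 6 := by
      gcongr
      norm_num
    linarith
  have hcube := cube_le_card_nsmul_sub_nsmul_image_log hA hd hd' hA₁ hA₂ h₁ h₂
  have hne' : (F + F).Nonempty := (hne.image _).add (hne.image _)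
  have hP := card_nsmul_sub_nsmul_mul_cube_le hne'
  rw [← hF] at hcube
  have hn₃ : (#A : ℝ) ≤ 4096 * K ^ 9 * (6 * (#A₂ / 3 : ℕ)) := by
    have h : (#A₂ : ℝ) ≤ 6 * (#A₂ / 3 : ℕ) := by exact_mod_cast (by omega : #A₂ ≤ 6 * (#A₂ / 3))
    exact hn₂.trans (by gcongr)
  have hx : (#A : ℝ) ^ 2 ≤ 4 * K ^ 3 * #(F + F) := by
    have h : (#A : ℝ) ^ 2 * (#A : ℝ) ^ 2 ≤ #(F + F) * mulEnergy A A := by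
      rw [hX]
      exact_mod_cast le_card_mul_mul_mulEnergy A A
    have h' : (mulEnergy A A : ℝ) ≤ 4 * (K * #A) ^ 2 * K :=
      (mulEnergy_le_card_add_sq_mul_harmonic hA).trans <|
        mul_le_mul (by gcongr) hH (by exact_mod_cast (harmonic_pos (by omega)).le) (by positivity)
    have h'' : (#(F + F) : ℝ) * mulEnergy A A ≤ #(F + F) * (4 * (K * #A) ^ 2 * K) := by gcongr
    refine le_of_mul_le_mul_right (h.trans (h''.trans_eq ?_)) (pow_pos hn0 2)
    ring
  have hP' : (#(2 • (F + F) - 2 • (F + F)) : ℝ) ≤ 64 * K ^ 13 * (#A : ℝ) ^ 2 := by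
    have h : (#(2 • (F + F) - 2 • (F + F)) : ℝ) * (#(F + F) : ℝ) ^ 3 ≤
        (#(F + F + (F + F)) : ℝ) ^ 4 := by exact_mod_cast hP
    have hXX' : (#(F + F + (F + F)) : ℝ) ≤ K * (#A : ℝ) ^ 2 :=
      (Nat.cast_le.2 hXX).trans hQ
    refine le_of_mul_le_mul_right ?_ (pow_pos hn0 6)
    calc (#(2 • (F + F) - 2 • (F + F)) : ℝ) * (#A : ℝ) ^ 6
        = #(2 • (F + F) - 2 • (F + F)) * ((#A : ℝ) ^ 2) ^ 3 := by ring
      _ ≤ #(2 • (F + F) - 2 • (F + F)) * (4 * K ^ 3 * #(F + F)) ^ 3 := by gcongr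
      _ = 64 * K ^ 9 * (#(2 • (F + F) - 2 • (F + F)) * (#(F + F) : ℝ) ^ 3) := by ring
      _ ≤ 64 * K ^ 9 * (K * (#A : ℝ) ^ 2) ^ 4 := by
        gcongr
        exact h.trans (by gcongr)
      _ = _ := by ring
  have hcube' : ((#A₂ / 3 : ℕ) : ℝ) ^ 3 ≤ 64 * K ^ 13 * (#A : ℝ) ^ 2 := by
    refine le_trans ?_ hP'
    exact_mod_cast hcube
  have hfinal : (#A : ℝ) * (#A : ℝ) ^ 2 ≤ 10 ^ 15 * K ^ 40 * (#A : ℝ) ^ 2 := by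
    calc (#A : ℝ) * (#A : ℝ) ^ 2 = (#A : ℝ) ^ 3 := by ring
      _ ≤ (4096 * K ^ 9 * (6 * (#A₂ / 3 : ℕ))) ^ 3 := by gcongr
      _ = (4096 * 6) ^ 3 * K ^ 27 * ((#A₂ / 3 : ℕ) : ℝ) ^ 3 := by ring
      _ ≤ (4096 * 6) ^ 3 * K ^ 27 * (64 * K ^ 13 * (#A : ℝ) ^ 2) := by gcongr
      _ = ((4096 * 6) ^ 3 * 64) * (K ^ 40 * (#A : ℝ) ^ 2) := by ring
      _ ≤ 10 ^ 15 * (K ^ 40 * (#A : ℝ) ^ 2) := by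
        gcongr
        norm_num
      _ = _ := by ring
  exact le_of_mul_le_mul_right hfinal (pow_pos hn0 2)

/-- Up to sign, a third of a set of reals is positive. -/
lemma exists_pos_subset (A : Finset ℝ) (hA : 3 ≤ #A) :
    ∃ B : Finset ℝ, (∀ b ∈ B, 0 < b) ∧ #A ≤ 3 * #B ∧ #B ≤ #A ∧ #(B + B) ≤ #(A + A) ∧
      #(B * B * B * B) ≤ #(A * A * A * A) := by
  classical
  have hcard : #A ≤ #(A.filter (0 < ·)) + #(A.filter (· < 0)) + 1 := by
    have h : A ⊆ insert 0 (A.filter (0 < ·) ∪ A.filter (· < 0)) := by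
      intro a ha
      rcases lt_trichotomy a 0 with h | h | h <;> simp [ha, h]
    exact (card_le_card h).trans ((card_insert_le _ _).trans (by grw [card_union_le]))
  rcases le_or_gt #A (3 * #(A.filter (0 < ·))) with h | h
  · refine ⟨A.filter (0 < ·), fun b hb => (mem_filter.1 hb).2, h, ?_, ?_, ?_⟩
    · exact card_le_card (filter_subset _ _)
    all_goals
      apply card_le_card
      gcongr <;> exact filter_subset _ _
  · refine ⟨-A.filter (· < 0), ?_, ?_, ?_, ?_, ?_⟩
    · intro b hb
      have := (mem_filter.1 (mem_neg'.1 hb)).2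
      linarith
    · rw [card_neg]
      omega
    · rw [card_neg]
      exact card_le_card (filter_subset _ _)
    · rw [← neg_add, card_neg]
      apply card_le_card
      gcongr <;> exact filter_subset _ _
    · simp only [mul_neg, neg_mul, neg_neg]
      apply card_le_card
      gcongr <;> exact filter_subset _ _

theorem stmt_3 :
    ∃ c₁ c₂ : ℝ, 0 < c₁ ∧ 0 < c₂ ∧ ∃ N : ℕ, ∀ A : Finset ℝ,
      N ≤ A.card →
      ((A + A).card : ℝ) ≤ (A.card : ℝ) ^ ((1 : ℝ) + c₁) →
      (A.card : ℝ) ^ ((2 : ℝ) + c₂) ≤ ((A * A * A * A).card : ℝ) := by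
  refine ⟨1 / 80, 1 / 80, by norm_num, by norm_num, ?_⟩
  have hlog : ∀ᶠ n : ℕ in Filter.atTop, 1 + Real.log n ≤ 9 * (n : ℝ) ^ (1 / 80 : ℝ) := by
    have h1 := ((isLittleO_log_rpow_atTop (r := 1 / 80) (by norm_num)).bound
      (c := 1) one_pos).natCast_atTop
    filter_upwards [h1, Filter.eventually_ge_atTop 1] with n hn hn1
    have h1n : (1 : ℝ) ≤ n := by exact_mod_cast hn1
    have h2 : (1 : ℝ) ≤ (n : ℝ) ^ (1 / 80 : ℝ) := Real.one_le_rpow h1n (by norm_num)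
    rw [Real.norm_of_nonneg (Real.log_nonneg h1n), Real.norm_of_nonneg (by positivity)] at hn
    linarith
  have hbig : ∀ᶠ n : ℕ in Filter.atTop, 3 * (10 ^ 15 * 9 ^ 40) < (n : ℝ) ^ (1 / 2 : ℝ) :=
    ((tendsto_rpow_atTop (by norm_num : (0 : ℝ) < 1 / 2)).comp
      tendsto_natCast_atTop_atTop).eventually_gt_atTop _
  obtain ⟨N, hN⟩ := Filter.eventually_atTop.1
    (hlog.and (hbig.and (Filter.eventually_ge_atTop 6)))
  refine ⟨N, fun A hNA hsum => ?_⟩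
  obtain ⟨hlogA, hbigA, hA6⟩ := hN _ hNA
  by_contra! hprod
  obtain ⟨B, hBpos, hAB, hBA, hBsum, hBprod⟩ := exists_pos_subset A (by omega)
  set T : ℝ := (#A : ℝ) ^ (1 / 80 : ℝ) with hT
  have hA0 : (0 : ℝ) < #A := by exact_mod_cast (by omega : 0 < #A)
  have hA1 : (1 : ℝ) ≤ #A := by exact_mod_cast (by omega : 1 ≤ #A)
  have hT1 : 1 ≤ T := Real.one_le_rpow hA1 (by norm_num)
  rw [Real.rpow_add hA0, Real.rpow_one, ← hT] at hsum
  rw [Real.rpow_add hA0, Real.rpow_two, ← hT] at hprod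
  have hAB' : (#A : ℝ) ≤ 3 * #B := by exact_mod_cast hAB
  have hmain := card_le_of_card_add_le_of_card_mul_le (K := 9 * T) hBpos (by omega)
    (by linarith) ?_ ?_ ?_
  · have hT40 : T ^ 40 = (#A : ℝ) ^ (1 / 2 : ℝ) := by
      rw [hT, ← Real.rpow_natCast, ← Real.rpow_mul hA0.le]
      congr 1
      norm_num
    have hsq : (#A : ℝ) = (#A : ℝ) ^ (1 / 2 : ℝ) * (#A : ℝ) ^ (1 / 2 : ℝ) := by
      rw [← Real.rpow_add hA0]
      norm_num
    rw [mul_pow, hT40] at hmain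
    have hpos : 0 < (#A : ℝ) ^ (1 / 2 : ℝ) := Real.rpow_pos_of_pos hA0 _
    have := mul_lt_mul_of_pos_right hbigA hpos
    linarith
  · have h : (#(B + B) : ℝ) ≤ #(A + A) := by exact_mod_cast hBsum
    nlinarith
  · have h : (#(B * B * B * B) : ℝ) ≤ #(A * A * A * A) := by exact_mod_cast hBprod
    calc (#(B * B * B * B) : ℝ) ≤ (#A : ℝ) ^ 2 * T := h.trans hprod.le
      _ ≤ (3 * #B : ℝ) ^ 2 * T := by gcongr
      _ = _ := by ring
  · have hB0 : (0 : ℝ) < #B := by exact_mod_cast (by omega : 0 < #B)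
    have h : Real.log #B ≤ Real.log #A := Real.log_le_log hB0 (by exact_mod_cast hBA)
    linarith [harmonic_le_one_add_log #B]
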